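/- For every ε > 0 there exists a positive integer n such that for every compact convex set K in the plane with nonempty interior, one can choose n extreme points of K (not necessarily distinct) with the property that every rectifiable curve passing through all these points has length at least ((1 − ε)/2) · (perimeter of K). -/

import Mathlib

open Set MeasureTheory

/-- The linear functional `x ↦ cos θ x₀ + sin θ x₁`. -/
noncomputable def dirL (θ : ℝ) : EuclideanSpace ℝ (Fin 2) →L[ℝ] ℝ :=
  Real.cos θ • EuclideanSpace.proj (𝕜 := ℝ) (0 : Fin 2) + Real.sin θ • EuclideanSpace.proj (𝕜 := ℝ) (1 : Fin 2)

lemma dirL_apply (θ : ℝ) (x : EuclideanSpace ℝ (Fin 2)) :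
    dirL θ x = Real.cos θ * x 0 + Real.sin θ * x 1 := by
  simp [dirL]

lemma exists_extreme_max {K : Set (EuclideanSpace ℝ (Fin 2))} (hK : IsCompact K)
    (hne : K.Nonempty) (l : EuclideanSpace ℝ (Fin 2) →L[ℝ] ℝ) :
    ∃ x ∈ Set.extremePoints ℝ K, ∀ y ∈ K, l y ≤ l x := by
  obtain ⟨x0, hx0, hmax⟩ := hK.exists_isMaxOn hne l.continuous.continuousOn
  have hexp : IsExposed ℝ K (l.toExposed K) := ContinuousLinearMap.toExposed.isExposed
  obtain ⟨y, hy⟩ := (hexp.isCompact hK).extremePoints_nonempty ⟨x0, hx0, fun y hy => hmax hy⟩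
  exact ⟨y, hexp.isExtreme.extremePoints_subset_extremePoints hy, hy.1.2⟩

lemma cos_sum_telescope (d φ : ℝ) (m : ℕ) :
    Real.sin (d / 2) * ∑ k ∈ Finset.range m, Real.cos (φ - k * d) =
      (Real.sin (φ + d / 2) - Real.sin (φ - m * d + d / 2)) / 2 := by
  induction m with
  | zero => simp
  | succ m ih =>
    rw [Finset.sum_range_succ, mul_add, ih]
    have h1 : φ - (m + 1 : ℕ) * d + d / 2 = (φ - m * d) - d / 2 := by push_cast; ring
    rw [h1, Real.sin_sub, Real.sin_add (φ - m * d)]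
    ring

lemma abs_cos_sum_le (m : ℕ) (hm : 2 ≤ m) (φ : ℝ) :
    Real.sin (Real.pi / m / 2) * ∑ k ∈ Finset.range m, |Real.cos (φ - k * (Real.pi / m))| ≤ 1 := by
  set d := Real.pi / m with hd
  have hm0 : (0 : ℝ) < m := by positivity
  have hdpos : 0 < d := by positivity
  have hmd : m * d = Real.pi := by rw [hd]; field_simp
  have hper : Function.Periodic (fun φ : ℝ => ∑ k ∈ Finset.range m, |Real.cos (φ - k * d)|) d := by
    intro x
    obtain ⟨n, rfl⟩ : ∃ n, m = n + 1 := ⟨m - 1, by omega⟩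
    beta_reduce
    rw [Finset.sum_range_succ', Finset.sum_range_succ]
    congr 1
    · apply Finset.sum_congr rfl
      intro k _
      congr 2
      push_cast; ring
    · have : x + d - (0 : ℕ) * d = (x - n * d) + Real.pi := by
        rw [← hmd]; push_cast; ring
      rw [this, Real.cos_add_pi, abs_neg]
  obtain ⟨y, hy, hxy⟩ := hper.exists_mem_Ico hdpos φ (Real.pi / 2 - d)
  rw [hxy]
  have : ∑ k ∈ Finset.range m, |Real.cos (y - k * d)| = ∑ k ∈ Finset.range m, Real.cos (y - k * d) := by
    apply Finset.sum_congr rfl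
    intro k hk
    rw [Finset.mem_range] at hk
    apply abs_of_nonneg
    have hk' : (k : ℝ) + 1 ≤ m := by exact_mod_cast hk
    have h2 : ((k : ℝ) + 1) * d ≤ Real.pi := by rw [← hmd]; gcongr
    have h3 : 0 ≤ (k : ℝ) * d := by positivity
    apply Real.cos_nonneg_of_neg_pi_div_two_le_of_le
    · linarith [hy.1]
    · linarith [hy.2]
  rw [this, cos_sum_telescope, hmd]
  linarith [Real.sin_le_one (y + d / 2), Real.neg_one_le_sin (y - Real.pi + d / 2)]

lemma dirL_sum_le (m : ℕ) (hm : 2 ≤ m) (v : EuclideanSpace ℝ (Fin 2)) :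
    Real.sin (Real.pi / m / 2) * ∑ k ∈ Finset.range m, |dirL (k * (Real.pi / m)) v| ≤ ‖v‖ := by
  set z : ℂ := ⟨v 0, v 1⟩ with hz
  have hn : ‖z‖ = ‖v‖ := by
    rw [EuclideanSpace.norm_eq, Complex.norm_def, Complex.normSq_apply]
    congr 1
    simp [Fin.sum_univ_two, hz]; ring
  have h0 : v 0 = ‖v‖ * Real.cos z.arg := by rw [← hn, Complex.norm_mul_cos_arg]
  have h1 : v 1 = ‖v‖ * Real.sin z.arg := by rw [← hn, Complex.norm_mul_sin_arg]
  have key : ∀ k : ℕ, |dirL (k * (Real.pi / m)) v| =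
      ‖v‖ * |Real.cos (z.arg - k * (Real.pi / m))| := by
    intro k
    have h2 : dirL (k * (Real.pi / m)) v = ‖v‖ * Real.cos (z.arg - k * (Real.pi / m)) := by
      rw [dirL_apply, Real.cos_sub]
      linear_combination Real.cos (k * (Real.pi / m)) * h0 + Real.sin (k * (Real.pi / m)) * h1
    rw [h2, abs_mul, abs_of_nonneg (norm_nonneg v)]
  simp_rw [key]
  rw [← Finset.mul_sum]
  have := abs_cos_sum_le m hm z.arg
  nlinarith [norm_nonneg v]

/-- The variational relation: `x` is the projection of `y` to `K`. -/
lemma proj_contract {x y x' y' : EuclideanSpace ℝ (Fin 2)}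
    (h1 : inner ℝ (y - x) (x' - x) ≤ 0) (h2 : inner ℝ (y' - x') (x - x') ≤ 0) :
    dist x x' ≤ dist y y' := by
  rw [dist_eq_norm, dist_eq_norm]
  have h3 : inner ℝ (y - y') (x - x') =
      ‖x - x'‖ * ‖x - x'‖ - inner ℝ (y - x) (x' - x) - inner ℝ (y' - x') (x - x') := by
    rw [← real_inner_self_eq_norm_mul_norm, show x' - x = -(x - x') by abel, inner_neg_right,
      show y - y' = (x - x') + (y - x) - (y' - x') by abel, inner_sub_left, inner_add_left]
    ring
  have h4 := real_inner_le_norm (y - y') (x - x')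
  by_contra hlt
  push Not at hlt
  nlinarith [norm_nonneg (y - y'), norm_nonneg (x - x')]

lemma exists_normal {K : Set (EuclideanSpace ℝ (Fin 2))} (hc : Convex ℝ K)
    (hi : (interior K).Nonempty) {x : EuclideanSpace ℝ (Fin 2)} (hx : x ∈ frontier K) :
    ∃ n : EuclideanSpace ℝ (Fin 2), n ≠ 0 ∧ ∀ z ∈ K, inner ℝ n (z - x) ≤ 0 := by
  obtain ⟨f, hf⟩ := geometric_hahn_banach_open_point hc.interior isOpen_interior hx.2
  set n := (InnerProductSpace.toDual ℝ (EuclideanSpace ℝ (Fin 2))).symm f with hn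
  have hnf : ∀ z, inner ℝ n z = f z := fun z => InnerProductSpace.toDual_symm_apply
  refine ⟨n, ?_, ?_⟩
  · intro h0
    obtain ⟨a, ha⟩ := hi
    have := hf a ha
    rw [← hnf, ← hnf, h0] at this
    simp at this
  · intro z hz
    rw [inner_sub_right, hnf, hnf, sub_nonpos]
    have hz' : z ∈ closure (interior K) := by
      rw [hc.closure_interior_eq_closure_of_nonempty_interior hi]
      exact subset_closure hz
    have hcl : IsClosed {z | f z ≤ f x} := isClosed_le f.continuous continuous_const
    exact closure_minimal (fun a ha => (hf a ha).le) hcl hz'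

lemma side_measure (α d a b c : ℝ) (hd : 0 < Real.sin d) :
    μH[1] {x : EuclideanSpace ℝ (Fin 2) |
      dirL α x = b ∧ dirL (α - d) x ≤ a ∧ dirL (α + d) x ≤ c} ≤
      ENNReal.ofReal ((a + c - 2 * b * Real.cos d) / Real.sin d) := by
  set g : ℝ → EuclideanSpace ℝ (Fin 2) := fun t =>
    !₂[b * Real.cos α - t * Real.sin α, b * Real.sin α + t * Real.cos α] with hg
  have hlip : LipschitzWith 1 g := by
    apply LipschitzWith.of_dist_le_mul
    intro s t
    rw [EuclideanSpace.dist_eq, Real.dist_eq]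
    simp only [hg, Fin.sum_univ_two, NNReal.coe_one, one_mul, Real.dist_eq, sq_abs]
    rw [← Real.sqrt_sq_eq_abs]
    apply Real.sqrt_le_sqrt
    simp
    nlinarith [Real.sin_sq_add_cos_sq α]
  have hsub : {x : EuclideanSpace ℝ (Fin 2) |
      dirL α x = b ∧ dirL (α - d) x ≤ a ∧ dirL (α + d) x ≤ c} ⊆
      g '' Icc ((b * Real.cos d - a) / Real.sin d) ((c - b * Real.cos d) / Real.sin d) := by
    rintro x ⟨h1, h2, h3⟩
    rw [dirL_apply] at h1 h2 h3
    rw [Real.cos_sub, Real.sin_sub] at h2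
    rw [Real.cos_add, Real.sin_add] at h3
    have hsc := Real.sin_sq_add_cos_sq α
    refine ⟨x 1 * Real.cos α - x 0 * Real.sin α, ⟨?_, ?_⟩, ?_⟩
    · rw [div_le_iff₀ hd, ← h1]; linarith
    · rw [le_div_iff₀ hd, ← h1]; linarith
    · ext i
      fin_cases i
      · simp [hg, ← h1]; linear_combination (x 0) * hsc
      · simp [hg, ← h1]; linear_combination (x 1) * hsc
  calc _ ≤ μH[1] (g '' _) := measure_mono hsub
    _ ≤ _ := hlip.hausdorffMeasure_image_le zero_le_one _
    _ = _ := by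
      rw [hausdorffMeasure_real, Real.volume_Icc]
      simp
      congr 1
      ring

lemma dirL_period (m : ℕ) (hm : 2 ≤ m) (k : ℕ) :
    dirL ((k + 2 * m : ℕ) * (Real.pi / m)) = dirL (k * (Real.pi / m)) := by
  have hm0 : (0 : ℝ) < m := by positivity
  have : ((k + 2 * m : ℕ) : ℝ) * (Real.pi / m) = k * (Real.pi / m) + 2 * Real.pi := by
    push_cast; field_simp
  ext x
  rw [this, dirL_apply, dirL_apply, Real.cos_add_two_pi, Real.sin_add_two_pi]

lemma dirL_half (m : ℕ) (hm : 2 ≤ m) (k : ℕ) (x : EuclideanSpace ℝ (Fin 2)) :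
    dirL ((k + m : ℕ) * (Real.pi / m)) x = - dirL (k * (Real.pi / m)) x := by
  have hm0 : (0 : ℝ) < m := by positivity
  have : ((k + m : ℕ) : ℝ) * (Real.pi / m) = k * (Real.pi / m) + Real.pi := by
    push_cast; field_simp
  rw [this, dirL_apply, dirL_apply, Real.cos_add_pi, Real.sin_add_pi]
  ring

lemma sin_pos_aux (m : ℕ) (hm : 2 ≤ m) : 0 < Real.sin (Real.pi / m) := by
  have hm0 : (0 : ℝ) < m := by positivity
  have hm2 : (2 : ℝ) ≤ m := by exact_mod_cast hm
  apply Real.sin_pos_of_pos_of_lt_pi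
  · positivity
  · rw [div_lt_iff₀ hm0]; nlinarith [Real.pi_pos]

lemma exists_pos_dir (m : ℕ) (hm : 2 ≤ m) {n : EuclideanSpace ℝ (Fin 2)} (hn : n ≠ 0) :
    ∃ k ∈ Finset.range (2 * m), 0 < dirL ((k + 1 : ℕ) * (Real.pi / m)) n := by
  by_contra! hcon
  have h0 : ∀ k < m, dirL ((k + 1 : ℕ) * (Real.pi / m)) n = 0 := by
    intro k hk
    have h1 := hcon k (by rw [Finset.mem_range]; omega)
    have h2 := hcon (k + m) (by rw [Finset.mem_range]; omega)
    rw [show k + m + 1 = (k + 1) + m by ring, dirL_half m hm] at h2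
    linarith
  have e1 := h0 0 (by omega)
  have e2 := h0 1 (by omega)
  have hs := sin_pos_aux m hm
  set d := Real.pi / m
  rw [show ((0 + 1 : ℕ) : ℝ) * d = d by push_cast; ring, dirL_apply] at e1
  rw [show ((1 + 1 : ℕ) : ℝ) * d = d + d by push_cast; ring, dirL_apply, Real.cos_add,
    Real.sin_add] at e2
  have hsc := Real.sin_sq_add_cos_sq d
  -- `n` is orthogonal to two independent directions
  have f1 : Real.sin d * (Real.cos d * n 1 - Real.sin d * n 0) = 0 := by
    linear_combination e2 - Real.cos d * e1
  have f2 : Real.cos d * n 1 - Real.sin d * n 0 = 0 :=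
    (mul_eq_zero.1 f1).resolve_left hs.ne'
  apply hn
  ext i
  fin_cases i
  · simp; linear_combination Real.cos d * e1 - Real.sin d * f2 - n 0 * hsc
  · simp; linear_combination Real.sin d * e1 + Real.cos d * f2 - n 1 * hsc

lemma perimeter_le (m : ℕ) (hm : 2 ≤ m) {K : Set (EuclideanSpace ℝ (Fin 2))} (hK : IsCompact K)
    (hc : Convex ℝ K) (hi : (interior K).Nonempty) (P : ℕ → EuclideanSpace ℝ (Fin 2))
    (hPK : ∀ k, P k ∈ K)
    (hP : ∀ k : ℕ, ∀ y ∈ K, dirL (k * (Real.pi / m)) y ≤ dirL (k * (Real.pi / m)) (P k)) :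
    μH[1] (frontier K) ≤ ENNReal.ofReal (2 * Real.tan (Real.pi / m / 2) *
      ∑ k ∈ Finset.range (2 * m), dirL (k * (Real.pi / m)) (P k)) := by
  have hsin := sin_pos_aux m hm
  have hm0 : (0 : ℝ) < m := by positivity
  set d := Real.pi / m with hd
  set h : ℕ → ℝ := fun k => dirL (k * d) (P k) with hh
  have hper : ∀ k, h (k + 2 * m) = h k := by
    intro k
    have e := dirL_period m hm k
    apply le_antisymm
    · simp only [hh]; rw [e]; exact hP k _ (hPK _)
    · have := hP (k + 2 * m) _ (hPK k)
      rw [e] at this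
      simp only [hh]; rw [e]; exact this
  have hne : K.Nonempty := hi.mono interior_subset
  -- projection
  have hproj : ∀ y : EuclideanSpace ℝ (Fin 2), ∃ x ∈ K, ∀ z ∈ K, inner ℝ (y - x) (z - x) ≤ 0 := by
    intro y
    obtain ⟨x, hx, hxe⟩ := exists_norm_eq_iInf_of_complete_convex hne hK.isComplete hc y
    exact ⟨x, hx, (norm_eq_iInf_iff_real_inner_le_zero hc hx).1 hxe⟩
  choose f hfK hf using hproj
  have hlip : LipschitzWith 1 f := by
    apply LipschitzWith.of_dist_le_mul
    intro y y'
    rw [NNReal.coe_one, one_mul]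
    exact proj_contract (hf y _ (hfK y')) (hf y' _ (hfK y))
  set S : ℕ → Set (EuclideanSpace ℝ (Fin 2)) := fun k =>
    {x | dirL ((k + 1 : ℕ) * d) x = h (k + 1) ∧ dirL ((k + 1 : ℕ) * d - d) x ≤ h k ∧
      dirL ((k + 1 : ℕ) * d + d) x ≤ h (k + 2)} with hS
  have e1 : ∀ k : ℕ, ((k + 1 : ℕ) : ℝ) * d - d = k * d := by intro k; push_cast; ring
  have e2 : ∀ k : ℕ, ((k + 1 : ℕ) : ℝ) * d + d = (k + 2 : ℕ) * d := by intro k; push_cast; ring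
  have hsub : frontier K ⊆ f '' (⋃ k ∈ Finset.range (2 * m), S k) := by
    intro x hx
    have hxK : x ∈ K := hK.isClosed.frontier_subset hx
    obtain ⟨n, hn, hnz⟩ := exists_normal hc hi hx
    set A := (Finset.range (2 * m)).filter (fun k => 0 < dirL ((k + 1 : ℕ) * d) n) with hA
    have hAne : A.Nonempty := by
      obtain ⟨k, hk, hk'⟩ := exists_pos_dir m hm hn
      exact ⟨k, Finset.mem_filter.2 ⟨hk, hk'⟩⟩
    obtain ⟨k, hkA, hkmin⟩ := A.exists_min_image
      (fun k => (h (k + 1) - dirL ((k + 1 : ℕ) * d) x) / dirL ((k + 1 : ℕ) * d) n) hAne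
    obtain ⟨hk, hkpos⟩ := Finset.mem_filter.1 hkA
    set t := (h (k + 1) - dirL ((k + 1 : ℕ) * d) x) / dirL ((k + 1 : ℕ) * d) n with ht
    have ht0 : 0 ≤ t := div_nonneg (sub_nonneg.2 (hP (k + 1) x hxK)) hkpos.le
    have hle : ∀ j < 2 * m, dirL ((j + 1 : ℕ) * d) (x + t • n) ≤ h (j + 1) := by
      intro j hj
      rw [map_add, map_smul, smul_eq_mul]
      by_cases hjp : 0 < dirL ((j + 1 : ℕ) * d) n
      · have := hkmin j (Finset.mem_filter.2 ⟨Finset.mem_range.2 hj, hjp⟩)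
        rw [le_div_iff₀ hjp] at this
        linarith
      · have h3 : t * dirL ((j + 1 : ℕ) * d) n ≤ 0 :=
          mul_nonpos_of_nonneg_of_nonpos ht0 (not_lt.1 hjp)
        have h4 : dirL ((j + 1 : ℕ) * d) x ≤ h (j + 1) := hP (j + 1) x hxK
        linarith
    have hle' : ∀ j ≤ 2 * m + 1, dirL ((j : ℕ) * d) (x + t • n) ≤ h j := by
      intro j hj
      rcases Nat.eq_zero_or_pos j with rfl | hj0
      · have h5 := hle (2 * m - 1) (by omega)
        rw [show 2 * m - 1 + 1 = 0 + 2 * m by omega, hper, dirL_period m hm] at h5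
        exact h5
      · by_cases hj2 : j = 2 * m + 1
        · have h5 := hle 0 (by omega)
          rw [hj2, show 2 * m + 1 = 1 + 2 * m by omega, hper, dirL_period m hm]
          simpa using h5
        · have h5 := hle (j - 1) (by omega)
          rwa [Nat.sub_add_cancel hj0] at h5
    refine ⟨x + t • n, ?_, ?_⟩
    · rw [Finset.mem_range] at hk
      simp only [Set.mem_iUnion]
      refine ⟨k, Finset.mem_range.2 hk, ?_, ?_, ?_⟩
      · rw [map_add, map_smul, smul_eq_mul, ht, div_mul_cancel₀ _ hkpos.ne']; ring
      · rw [e1]; exact hle' k (by omega)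
      · rw [e2]; exact hle' (k + 2) (by omega)
    · have h6 : inner ℝ (x + t • n - x) (f (x + t • n) - x) ≤ 0 := by
        rw [add_sub_cancel_left, inner_smul_left]
        exact mul_nonpos_of_nonneg_of_nonpos (by simpa using ht0) (hnz _ (hfK _))
      have h7 := proj_contract (hf (x + t • n) x hxK) h6
      rw [dist_self] at h7
      exact dist_le_zero.1 h7
  have hcd : 0 < Real.cos (d / 2) := by
    have hm2 : (2 : ℝ) ≤ m := by exact_mod_cast hm
    have : d < Real.pi := by rw [hd, div_lt_iff₀ hm0]; nlinarith [Real.pi_pos]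
    have hd0 : 0 < d := by positivity
    apply Real.cos_pos_of_mem_Ioo
    constructor <;> linarith
  calc μH[1] (frontier K) ≤ μH[1] (f '' (⋃ k ∈ Finset.range (2 * m), S k)) := measure_mono hsub
    _ ≤ μH[1] (⋃ k ∈ Finset.range (2 * m), S k) := by
      simpa using hlip.hausdorffMeasure_image_le (d := 1) zero_le_one
        (⋃ k ∈ Finset.range (2 * m), S k)
    _ ≤ ∑ k ∈ Finset.range (2 * m), μH[1] (S k) := measure_biUnion_finset_le _ _
    _ ≤ ∑ k ∈ Finset.range (2 * m), ENNReal.ofReal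
          ((h k + h (k + 2) - 2 * h (k + 1) * Real.cos d) / Real.sin d) :=
      Finset.sum_le_sum fun k _ => side_measure _ _ _ _ _ hsin
    _ = ENNReal.ofReal (∑ k ∈ Finset.range (2 * m),
          (h k + h (k + 2) - 2 * h (k + 1) * Real.cos d) / Real.sin d) := by
      rw [ENNReal.ofReal_sum_of_nonneg]
      intro k _
      apply div_nonneg _ hsin.le
      have g1 : dirL (k * d) (P (k + 1)) ≤ h k := hP k _ (hPK _)
      have g2 : dirL ((k + 2 : ℕ) * d) (P (k + 1)) ≤ h (k + 2) := hP (k + 2) _ (hPK _)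
      have g3 : h (k + 1) = dirL ((k + 1 : ℕ) * d) (P (k + 1)) := rfl
      rw [← e1, dirL_apply, Real.cos_sub, Real.sin_sub] at g1
      rw [← e2, dirL_apply, Real.cos_add, Real.sin_add] at g2
      rw [g3, dirL_apply]
      linarith
    _ = _ := by
      congr 1
      have s1 : ∑ k ∈ Finset.range (2 * m), h (k + 1) = ∑ k ∈ Finset.range (2 * m), h k := by
        have a1 := Finset.sum_range_succ h (2 * m)
        have a2 := Finset.sum_range_succ' h (2 * m)
        have a3 := hper 0
        rw [zero_add] at a3
        linarith
      have s2 : ∑ k ∈ Finset.range (2 * m), h (k + 2) = ∑ k ∈ Finset.range (2 * m), h (k + 1) := by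
        have a1 := Finset.sum_range_succ (fun k => h (k + 1)) (2 * m)
        have a2 := Finset.sum_range_succ' (fun k => h (k + 1)) (2 * m)
        have a3 := hper 1
        rw [add_comm 1] at a3
        simp only [zero_add, add_assoc, one_add_one_eq_two] at a1 a2 
        linarith
      rw [← Finset.sum_div, Finset.sum_sub_distrib, Finset.sum_add_distrib, ← Finset.sum_mul,
        ← Finset.mul_sum, s2, s1]
      set H := ∑ k ∈ Finset.range (2 * m), h k
      have hH : ∑ k ∈ Finset.range (2 * m), dirL (k * d) (P k) = H := rfl
      have t1 : Real.sin d = 2 * Real.sin (d / 2) * Real.cos (d / 2) := by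
        rw [← Real.sin_two_mul]; congr 1; ring
      have t2 : Real.cos d = 1 - 2 * Real.sin (d / 2) ^ 2 := by
        have := Real.cos_two_mul (d / 2)
        rw [show 2 * (d / 2) = d by ring] at this
        rw [this]; linear_combination 2 * Real.sin_sq_add_cos_sq (d / 2)
      rw [Real.tan_eq_sin_div_cos, t2]
      rw [t1] at hsin ⊢
      have hs2 : Real.sin (d / 2) ≠ 0 := by
        intro h0; rw [h0] at hsin; simp at hsin
      field_simp
      ring

lemma sum_width_le (m : ℕ) (hm : 2 ≤ m) (γ : ℝ → EuclideanSpace ℝ (Fin 2))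
    (hγ : eVariationOn γ (Icc 0 1) ≠ ⊤) (a b : ℕ → ℝ)
    (ha : ∀ k < m, a k ∈ Icc (0 : ℝ) 1) (hb : ∀ k < m, b k ∈ Icc (0 : ℝ) 1) :
    Real.sin (Real.pi / m / 2) *
      ∑ k ∈ Finset.range m, |dirL (k * (Real.pi / m)) (γ (a k) - γ (b k))| ≤
      (eVariationOn γ (Icc 0 1)).toReal := by
  classical
  set T : Finset ℝ := (Finset.range m).image a ∪ (Finset.range m).image b with hT
  have hTI : ∀ x ∈ T, x ∈ Icc (0 : ℝ) 1 := by
    intro x hx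
    rcases Finset.mem_union.1 hx with hx | hx
    · obtain ⟨k, hk, rfl⟩ := Finset.mem_image.1 hx
      exact ha k (Finset.mem_range.1 hk)
    · obtain ⟨k, hk, rfl⟩ := Finset.mem_image.1 hx
      exact hb k (Finset.mem_range.1 hk)
  have hTne : 0 < T.card := by
    rw [Finset.card_pos]
    exact ⟨a 0, Finset.mem_union_left _ (Finset.mem_image_of_mem _ (Finset.mem_range.2 (by omega)))⟩
  set N := T.card with hN
  set t : ℕ → ℝ := fun i => T.orderEmbOfFin hN.symm ⟨min i (N - 1), by omega⟩ with ht
  have hmono : Monotone t := by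
    intro i j hij
    apply (T.orderEmbOfFin hN.symm).monotone
    rw [Fin.mk_le_mk]
    omega
  have htT : ∀ i, t i ∈ T := fun i => T.orderEmbOfFin_mem _ _
  have hsurj : ∀ x ∈ T, ∃ i ≤ N, t i = x := by
    intro x hx
    have : x ∈ Set.range (T.orderEmbOfFin hN.symm) := by
      rw [Finset.range_orderEmbOfFin]; exact hx
    obtain ⟨i, rfl⟩ := this
    refine ⟨i, i.2.le, ?_⟩
    simp only [ht]
    congr 1
    ext
    simp only
    omega
  have hsum := eVariationOn.sum_le (f := γ) (n := N) hmono (fun i => hTI _ (htT i))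
  have hsumReal : ∑ i ∈ Finset.range N, ‖γ (t (i + 1)) - γ (t i)‖ ≤
      (eVariationOn γ (Icc 0 1)).toReal := by
    have h1 := ENNReal.toReal_mono hγ hsum
    rw [ENNReal.toReal_sum (fun i _ => edist_ne_top _ _)] at h1
    simpa [← dist_edist, dist_eq_norm] using h1
  have hs : 0 ≤ Real.sin (Real.pi / m / 2) := by
    have hm1 : (1 : ℝ) ≤ m := by exact_mod_cast (by omega : 1 ≤ m)
    apply Real.sin_nonneg_of_nonneg_of_le_pi
    · positivity
    · have : Real.pi / m ≤ Real.pi := div_le_self Real.pi_pos.le hm1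
      linarith [Real.pi_pos]
  have hone : ∀ (l : EuclideanSpace ℝ (Fin 2) →L[ℝ] ℝ), ∀ i ≤ N, ∀ j ≤ N, i ≤ j →
      |l (γ (t i) - γ (t j))| ≤ ∑ i ∈ Finset.range N, |l (γ (t (i + 1)) - γ (t i))| := by
    intro l i hi j hj hij
    have h1 := dist_le_Ico_sum_dist (fun i => l (γ (t i))) hij
    simp only [Real.dist_eq, ← map_sub] at h1
    refine h1.trans ?_
    have h2 : ∀ i, |l (γ (t i) - γ (t (i + 1)))| = |l (γ (t (i + 1)) - γ (t i))| := by
      intro i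
      rw [← abs_neg, ← map_neg, neg_sub]
    simp only [h2]
    apply Finset.sum_le_sum_of_subset_of_nonneg
    · intro q hq
      rw [Finset.mem_Ico] at hq
      exact Finset.mem_range.2 (by omega)
    · intros; positivity
  have htwo : ∀ (l : EuclideanSpace ℝ (Fin 2) →L[ℝ] ℝ), ∀ x ∈ T, ∀ y ∈ T,
      |l (γ x - γ y)| ≤ ∑ i ∈ Finset.range N, |l (γ (t (i + 1)) - γ (t i))| := by
    intro l x hx y hy
    obtain ⟨i, hi, rfl⟩ := hsurj x hx
    obtain ⟨j, hj, rfl⟩ := hsurj y hy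
    rcases le_total i j with hij | hij
    · exact hone l i hi j hj hij
    · rw [← abs_neg, ← map_neg, neg_sub]
      exact hone l j hj i hi hij
  calc _ ≤ Real.sin (Real.pi / m / 2) * ∑ k ∈ Finset.range m, ∑ i ∈ Finset.range N,
        |dirL (k * (Real.pi / m)) (γ (t (i + 1)) - γ (t i))| := by
        apply mul_le_mul_of_nonneg_left _ hs
        apply Finset.sum_le_sum
        intro k hk
        exact htwo _ _ (Finset.mem_union_left _ (Finset.mem_image_of_mem _ hk)) _
          (Finset.mem_union_right _ (Finset.mem_image_of_mem _ hk))
    _ = ∑ i ∈ Finset.range N, Real.sin (Real.pi / m / 2) * ∑ k ∈ Finset.range m,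
        |dirL (k * (Real.pi / m)) (γ (t (i + 1)) - γ (t i))| := by
        rw [Finset.sum_comm, Finset.mul_sum]
    _ ≤ ∑ i ∈ Finset.range N, ‖γ (t (i + 1)) - γ (t i)‖ :=
        Finset.sum_le_sum fun i _ => dirL_sum_le m hm _
    _ ≤ _ := hsumReal

/-- For every `ε > 0` there is an `n` such that for every planar compact convex body `K`
one can choose `n` extreme points of `K` (not necessarily distinct) such that every
rectifiable curve passing through all of them has length at least
`((1 − ε)/2) · per K`. -/
theorem stmt7 (ε : ℝ) (hε : 0 < ε) :
    ∃ n : ℕ, 0 < n ∧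
      ∀ K : Set (EuclideanSpace ℝ (Fin 2)),
        IsCompact K → Convex ℝ K → (interior K).Nonempty →
        ∃ p : Fin n → EuclideanSpace ℝ (Fin 2),
          (∀ i, p i ∈ Set.extremePoints ℝ K) ∧
          ∀ γ : ℝ → EuclideanSpace ℝ (Fin 2), ContinuousOn γ (Icc 0 1) →
            eVariationOn γ (Icc 0 1) ≠ ⊤ → (∀ i, p i ∈ γ '' Icc 0 1) →
            ENNReal.ofReal ((1 - ε) / 2) * μH[1] (frontier K) ≤
              eVariationOn γ (Icc 0 1) := by
  obtain ⟨m, hm, hcos⟩ : ∃ m : ℕ, 2 ≤ m ∧ 1 - ε ≤ Real.cos (Real.pi / m / 2) := by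
    have h1 : Filter.Tendsto (fun m : ℕ => Real.cos (Real.pi / m / 2)) Filter.atTop (nhds 1) := by
      have h2 : Filter.Tendsto (fun m : ℕ => Real.pi / m / 2) Filter.atTop (nhds (0 / 2)) :=
        (tendsto_const_div_atTop_nhds_zero_nat Real.pi).div_const 2
      have h3 := (Real.continuous_cos.tendsto (0 / 2)).comp h2
      rw [zero_div, Real.cos_zero] at h3
      exact h3
    obtain ⟨m, h2, h3⟩ := ((h1.eventually (lt_mem_nhds (show 1 - ε < 1 by linarith))).and
      (Filter.eventually_ge_atTop 2)).exists
    exact ⟨m, h3, h2.le⟩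
  refine ⟨2 * m, by omega, ?_⟩
  intro K hK hc hi
  have hne : K.Nonempty := hi.mono interior_subset
  choose P hPe hP using fun k : ℕ => exists_extreme_max hK hne (dirL (k * (Real.pi / m)))
  refine ⟨fun i => P i, fun i => hPe i, ?_⟩
  intro γ _ hγ hpass
  have hpass' : ∀ k < 2 * m, ∃ s ∈ Icc (0 : ℝ) 1, γ s = P k := fun k hk => hpass ⟨k, hk⟩
  have hex : ∀ k : ℕ, ∃ s : ℝ, k < 2 * m → s ∈ Icc (0 : ℝ) 1 ∧ γ s = P k := by
    intro k
    by_cases hk : k < 2 * m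
    · obtain ⟨s, hs, hs'⟩ := hpass' k hk
      exact ⟨s, fun _ => ⟨hs, hs'⟩⟩
    · exact ⟨0, fun h => absurd h hk⟩
  choose s hs using hex
  have hper := perimeter_le m hm hK hc hi P (fun k => (hPe k).1) hP
  have hlen := sum_width_le m hm γ hγ s (fun k => s (k + m))
    (fun k hk => (hs k (by omega)).1) (fun k hk => (hs (k + m) (by omega)).1)
  set L := (eVariationOn γ (Icc 0 1)).toReal with hL
  set W := ∑ k ∈ Finset.range (2 * m), dirL (k * (Real.pi / m)) (P k) with hW
  have hWeq : ∑ k ∈ Finset.range m,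
      |dirL (k * (Real.pi / m)) (γ (s k) - γ (s (k + m)))| = W := by
    rw [hW, two_mul, Finset.sum_range_add, ← Finset.sum_add_distrib]
    apply Finset.sum_congr rfl
    intro k hk
    rw [Finset.mem_range] at hk
    rw [(hs k (by omega)).2, (hs (k + m) (by omega)).2, map_sub, abs_of_nonneg, add_comm m k,
      dirL_half m hm]
    · ring
    · exact sub_nonneg.2 (hP k _ (hPe _).1)
  have hWnn : 0 ≤ W := by rw [← hWeq]; positivity
  rw [hWeq] at hlen
  have hsin2 : 0 < Real.sin (Real.pi / m) := sin_pos_aux m hm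
  have hfin : eVariationOn γ (Icc 0 1) = ENNReal.ofReal L := (ENNReal.ofReal_toReal hγ).symm
  have hLnn : 0 ≤ L := ENNReal.toReal_nonneg
  rcases le_or_gt 1 ε with h1 | h1
  · rw [ENNReal.ofReal_of_nonpos (by linarith)]; simp
  · have hcpos : 0 < Real.cos (Real.pi / m / 2) := by linarith
    calc _ ≤ ENNReal.ofReal ((1 - ε) / 2) * ENNReal.ofReal (2 * Real.tan (Real.pi / m / 2) * W) := by
          gcongr
      _ = ENNReal.ofReal ((1 - ε) / 2 * (2 * Real.tan (Real.pi / m / 2) * W)) := by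
          exact (ENNReal.ofReal_mul (by linarith)).symm
      _ ≤ ENNReal.ofReal L := by
          apply ENNReal.ofReal_le_ofReal
          rw [Real.tan_eq_sin_div_cos]
          have h5 : (1 - ε) / 2 * (2 * (Real.sin (Real.pi / m / 2) / Real.cos (Real.pi / m / 2)) * W)
            = (1 - ε) / Real.cos (Real.pi / m / 2) * (Real.sin (Real.pi / m / 2) * W) := by
            field_simp
          rw [h5]
          have h6 : (1 - ε) / Real.cos (Real.pi / m / 2) ≤ 1 := by
            rw [div_le_one hcpos]; exact hcos
          have h7 : 0 ≤ (1 - ε) / Real.cos (Real.pi / m / 2) := div_nonneg (by linarith) hcpos.le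
          nlinarith
      _ = _ := hfin.symm
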